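/- Let Ā ∈ S^m₊ with rank r and let Ē ∈ ℝ^{m×(m−r)} have orthonormal columns spanning Ker(Ā). Then there is a neighborhood of Ā in Sᵐ and an analytic map E : Sᵐ → ℝ^{m×(m−r)} on it with E(Ā) = Ē such that for all A near Ā, the columns of E(A) form an orthonormal basis of the span of the eigenvectors associated with the m − r smallest eigenvalues of A. -/

import Mathlib

open scoped Matrix

attribute [local instance] Matrix.normedAddCommGroup Matrix.normedSpace

open scoped Topology ContDiff

section MatrixCalculus

variable {n k l : Type*} [Fintype n] [Fintype k] [Fintype l]
  {X : Type*} [NormedAddCommGroup X] [NormedSpace ℝ X]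

lemma contDiff_matrix_iff {f : X → Matrix n k ℝ} :
    ContDiff ℝ ω f ↔ ∀ i j, ContDiff ℝ ω fun x => f x i j :=
  contDiff_pi.trans (forall_congr' fun _ => contDiff_pi)

lemma ContDiff.matrix_mul {f : X → Matrix n k ℝ} {g : X → Matrix k l ℝ}
    (hf : ContDiff ℝ ω f) (hg : ContDiff ℝ ω g) : ContDiff ℝ ω fun x => f x * g x := by
  rw [contDiff_matrix_iff] at *
  intro i j
  simp only [Matrix.mul_apply]
  exact ContDiff.sum fun a _ => (hf i a).mul (hg a j)

lemma ContDiff.matrix_transpose {f : X → Matrix n k ℝ} (hf : ContDiff ℝ ω f) :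
    ContDiff ℝ ω fun x => (f x)ᵀ := by
  rw [contDiff_matrix_iff] at *
  exact fun i j => hf j i

end MatrixCalculus

section Frame

variable {n k : Type*} [Fintype n] [Fintype k] [DecidableEq n] [DecidableEq k]

/-- A map whose zeros `(A, E)` near `(Abar, Ebar)` are the pairs where `E` has orthonormal columns,
`Ebarᵀ * E` is symmetric and the column space of `E` is invariant under `A`. -/
def invariantFrameMap (Ebar : Matrix n k ℝ) (p : Matrix n n ℝ × Matrix n k ℝ) : Matrix n k ℝ :=
  (1 - Ebar * Ebarᵀ) * (p.1 * p.2 - p.2 * (p.2ᵀ * (p.1 * p.2))) +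
    Ebar * ((p.2ᵀ * p.2 - 1) + (Ebarᵀ * p.2 - p.2ᵀ * Ebar))

lemma contDiff_invariantFrameMap (Ebar : Matrix n k ℝ) :
    ContDiff ℝ ω (invariantFrameMap Ebar) := by
  have h1 : ContDiff ℝ ω fun p : Matrix n n ℝ × Matrix n k ℝ => p.1 := contDiff_fst
  have h2 : ContDiff ℝ ω fun p : Matrix n n ℝ × Matrix n k ℝ => p.2 := contDiff_snd
  have h3 := h1.matrix_mul h2
  exact (contDiff_const.matrix_mul (h3.sub (h2.matrix_mul (h2.matrix_transpose.matrix_mul h3)))).add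
    (contDiff_const.matrix_mul (((h2.matrix_transpose.matrix_mul h2).sub contDiff_const).add
      ((contDiff_const.matrix_mul h2).sub (h2.matrix_transpose.matrix_mul contDiff_const))))

variable {Abar : Matrix n n ℝ} {Ebar : Matrix n k ℝ}

lemma invariantFrameMap_add_smul (horth : Ebarᵀ * Ebar = 1) (hAE : Abar * Ebar = 0)
    (hEA : Ebarᵀ * Abar = 0) (H : Matrix n k ℝ) (t : ℝ) :
    invariantFrameMap Ebar (Abar, Ebar + t • H) =
      t • (Abar * H + (2 : ℝ) • (Ebar * (Ebarᵀ * H))) + t ^ 2 • (Ebar * (Hᵀ * H)) -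
        t ^ 3 • ((1 - Ebar * Ebarᵀ) * (H * (Hᵀ * (Abar * H)))) := by
  have hEA' (M : Matrix n k ℝ) : Ebarᵀ * (Abar * M) = 0 := by
    rw [← Matrix.mul_assoc, hEA, Matrix.zero_mul]
  have hEE (M : Matrix k k ℝ) : Ebarᵀ * (Ebar * M) = M := by
    rw [← Matrix.mul_assoc, horth, Matrix.one_mul]
  simp only [invariantFrameMap, Matrix.mul_add, Matrix.add_mul, Matrix.mul_sub, Matrix.sub_mul,
    Matrix.mul_assoc, hAE, horth, Matrix.transpose_add, Matrix.transpose_smul, Matrix.mul_smul,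
    Matrix.smul_mul, hEA', hEE, Matrix.mul_zero, Matrix.one_mul, Matrix.mul_one,
    zero_add, sub_zero]
  module

lemma fderiv_invariantFrameMap_apply (horth : Ebarᵀ * Ebar = 1) (hAE : Abar * Ebar = 0)
    (hEA : Ebarᵀ * Abar = 0) (H : Matrix n k ℝ) :
    fderiv ℝ (invariantFrameMap Ebar) (Abar, Ebar) (0, H) =
      Abar * H + (2 : ℝ) • (Ebar * (Ebarᵀ * H)) := by
  have hd : HasFDerivAt (invariantFrameMap Ebar) (fderiv ℝ (invariantFrameMap Ebar) (Abar, Ebar))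
      (Abar, Ebar) :=
    ((contDiff_invariantFrameMap Ebar).differentiable (by simp) _).hasFDerivAt
  have h1 := hd.hasLineDerivAt (0, H)
  refine HasDerivAt.unique (h1 : HasDerivAt _ _ _) ?_
  have h2 : (fun t : ℝ => invariantFrameMap Ebar ((Abar, Ebar) + t • ((0 : Matrix n n ℝ), H))) =
      fun t => t • (Abar * H + (2 : ℝ) • (Ebar * (Ebarᵀ * H))) + t ^ 2 • (Ebar * (Hᵀ * H)) -
        t ^ 3 • ((1 - Ebar * Ebarᵀ) * (H * (Hᵀ * (Abar * H)))) := by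
    funext t
    rw [← invariantFrameMap_add_smul horth hAE hEA]
    simp
  rw [h2]
  have h3 := (((hasDerivAt_id (0 : ℝ)).smul_const
    (Abar * H + (2 : ℝ) • (Ebar * (Ebarᵀ * H)))).add
      ((hasDerivAt_pow 2 (0 : ℝ)).smul_const (Ebar * (Hᵀ * H)))).sub
        ((hasDerivAt_pow 3 (0 : ℝ)).smul_const ((1 - Ebar * Ebarᵀ) * (H * (Hᵀ * (Abar * H)))))
  simpa using! h3

lemma invariantFrameMap_eq_zero {A : Matrix n n ℝ} {E : Matrix n k ℝ}
    (horth : Ebarᵀ * Ebar = 1) (hdet : (Eᵀ * Ebar).det ≠ 0)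
    (h : invariantFrameMap Ebar (A, E) = 0) :
    Eᵀ * E = 1 ∧ A * E = E * (Eᵀ * (A * E)) := by
  have hEE (M : Matrix k k ℝ) : Ebarᵀ * (Ebar * M) = M := by
    rw [← Matrix.mul_assoc, horth, Matrix.one_mul]
  have hP (M : Matrix n k ℝ) : Ebarᵀ * ((1 - Ebar * Ebarᵀ) * M) = 0 := by
    simp [Matrix.sub_mul, Matrix.mul_sub, Matrix.mul_assoc, hEE]
  have hST : (Eᵀ * E - 1) + (Ebarᵀ * E - Eᵀ * Ebar) = 0 := by
    have := congrArg (Ebarᵀ * ·) h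
    simpa only [invariantFrameMap, Matrix.mul_add, hP, hEE, zero_add, Matrix.mul_zero] using this
  have hS : Eᵀ * E = 1 := by
    have hT := congrArg Matrix.transpose hST
    simp only [Matrix.transpose_add, Matrix.transpose_sub, Matrix.transpose_mul,
      Matrix.transpose_transpose, Matrix.transpose_one, Matrix.transpose_zero] at hT
    have h2 : (2 : ℝ) • (Eᵀ * E - 1) = 0 := by
      rw [← add_zero (0 : Matrix k k ℝ)]
      nth_rewrite 1 [← hST]
      rw [← hT]
      module
    exact sub_eq_zero.mp ((smul_eq_zero_iff_right two_ne_zero).mp h2)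
  refine ⟨hS, ?_⟩
  set W := A * E - E * (Eᵀ * (A * E)) with hW
  have hEW : Eᵀ * W = 0 := by
    rw [hW, Matrix.mul_sub, ← Matrix.mul_assoc Eᵀ E, hS, Matrix.one_mul, sub_self]
  have hWP : W = Ebar * (Ebarᵀ * W) := by
    simp only [invariantFrameMap, hST, Matrix.mul_zero, add_zero, ← hW, Matrix.sub_mul,
      Matrix.one_mul, Matrix.mul_assoc] at h
    exact sub_eq_zero.mp h
  have h0 : Ebarᵀ * W = 0 := by
    have hu : IsUnit (Eᵀ * Ebar).det := isUnit_iff_ne_zero.mpr hdet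
    rw [← Matrix.nonsing_inv_mul_cancel_left _ (Ebarᵀ * W) hu, Matrix.mul_assoc Eᵀ, ← hWP, hEW,
      Matrix.mul_zero]
  rw [h0, Matrix.mul_zero] at hWP
  exact sub_eq_zero.mp hWP

/-- Analytic continuation of an orthonormal frame of the kernel of a symmetric matrix to
orthonormal frames of invariant subspaces of nearby matrices. -/
theorem exists_analyticAt_invariant_frame (hsymm : Abar.IsSymm) (horth : Ebarᵀ * Ebar = 1)
    (hAE : Abar * Ebar = 0) (hker : ∀ x, Abar *ᵥ x = 0 → ∃ c, Ebar *ᵥ c = x) :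
    ∃ E : Matrix n n ℝ → Matrix n k ℝ, AnalyticAt ℝ E Abar ∧ E Abar = Ebar ∧
      ∀ᶠ A in 𝓝 Abar, (E A)ᵀ * E A = 1 ∧ A * E A = E A * ((E A)ᵀ * (A * E A)) := by
  have hEA : Ebarᵀ * Abar = 0 := by
    rw [← hsymm.eq, ← Matrix.transpose_mul, hAE, Matrix.transpose_zero]
  have hcd : ContDiffAt ℝ ω (invariantFrameMap Ebar) (Abar, Ebar) :=
    (contDiff_invariantFrameMap Ebar).contDiffAt
  have hinj : Function.Injective
      (fderiv ℝ (invariantFrameMap Ebar) (Abar, Ebar) ∘L .inr ℝ (Matrix n n ℝ) (Matrix n k ℝ)) := by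
    rw [injective_iff_map_eq_zero]
    intro H hH
    have hL : Abar * H + (2 : ℝ) • (Ebar * (Ebarᵀ * H)) = 0 := by
      rw [← fderiv_invariantFrameMap_apply horth hAE hEA H]
      exact hH
    have hEH : Ebarᵀ * H = 0 := by
      have := congrArg (Ebarᵀ * ·) hL
      simp only [Matrix.mul_add, Matrix.mul_smul, ← Matrix.mul_assoc, hEA, horth, Matrix.zero_mul,
        Matrix.one_mul, zero_add, Matrix.mul_zero] at this
      exact (smul_eq_zero_iff_right two_ne_zero).mp this
    have hAH : Abar * H = 0 := by simpa [hEH] using hL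
    ext i j
    obtain ⟨c, hc⟩ := hker (H.col j) (by
      ext a
      simpa [Matrix.mul_apply, Matrix.mulVec, dotProduct] using congrFun (congrFun hAH a) j)
    have hc0 : c = 0 := by
      have h1 : Ebarᵀ *ᵥ (Ebar *ᵥ c) = c := by rw [Matrix.mulVec_mulVec, horth, Matrix.one_mulVec]
      rw [← h1, hc]
      ext a
      simpa [Matrix.mul_apply, Matrix.mulVec, dotProduct] using congrFun (congrFun hEH a) j
    rw [hc0, Matrix.mulVec_zero] at hc
    exact (congrFun hc i).symm
  have hinv : (fderiv ℝ (invariantFrameMap Ebar) (Abar, Ebar) ∘L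
      .inr ℝ (Matrix n n ℝ) (Matrix n k ℝ)).IsInvertible :=
    ⟨(LinearEquiv.ofInjectiveEndo _ hinj).toContinuousLinearEquiv, by ext; rfl⟩
  have hE0 : hcd.implicitFunction (by simp) hinv Abar = Ebar :=
    hcd.implicitFunction_apply_self (by simp) hinv
  have hEc := hcd.contDiffAt_implicitFunction (by simp) hinv
  have hEe := hcd.eventually_apply_implicitFunction (by simp) hinv
  generalize hcd.implicitFunction _ hinv = E at hE0 hEc hEe
  refine ⟨E, hEc.analyticAt, hE0, ?_⟩
  have hzero : invariantFrameMap Ebar (Abar, Ebar) = 0 := by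
    simpa using invariantFrameMap_add_smul horth hAE hEA 0 0
  have hdet : ∀ᶠ A in 𝓝 Abar, ((E A)ᵀ * Ebar).det ≠ 0 := by
    have hc : ContinuousAt (fun A => ((E A)ᵀ * Ebar).det) Abar := by
      have : Continuous fun M : Matrix n k ℝ => (Mᵀ * Ebar).det := by fun_prop
      exact this.continuousAt.comp hEc.continuousAt
    exact hc.eventually_ne (by simp [hE0, horth])
  filter_upwards [hEe, hdet] with A hA hd
  exact invariantFrameMap_eq_zero horth hd (hA.trans hzero)

end Frame

section Eigenvectors

lemma Matrix.eventually_dotProduct_mulVec_pos {n : Type*} [Fintype n] {M : Matrix n n ℝ}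
    (hM : ∀ x ≠ 0, 0 < x ⬝ᵥ M *ᵥ x) : ∀ᶠ B in 𝓝 M, ∀ x ≠ 0, 0 < x ⬝ᵥ B *ᵥ x := by
  have hcont : Continuous fun p : Matrix n n ℝ × (n → ℝ) => p.2 ⬝ᵥ p.1 *ᵥ p.2 := by fun_prop
  have hsphere : ∀ᶠ B in 𝓝 M, ∀ x ∈ Metric.sphere (0 : n → ℝ) 1, 0 < x ⬝ᵥ B *ᵥ x :=
    (isCompact_sphere _ _).eventually_forall_of_forall_eventually fun x hx =>
      hcont.continuousAt.eventually (lt_mem_nhds (hM x (ne_zero_of_mem_unit_sphere ⟨x, hx⟩)))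
  filter_upwards [hsphere] with B hB x hx
  have hpos : 0 < ‖x‖⁻¹ := inv_pos.mpr (norm_pos_iff.mpr hx)
  have := hB (‖x‖⁻¹ • x) (by simp [norm_smul, hx])
  rw [Matrix.mulVec_smul, dotProduct_smul, smul_dotProduct, smul_eq_mul, smul_eq_mul] at this
  exact pos_of_mul_pos_right (pos_of_mul_pos_right this hpos.le) hpos.le

lemma exists_pos_dotProduct_sub_smul_one_mulVec_pos {n : Type*} [Fintype n] [DecidableEq n]
    {M : Matrix n n ℝ} (hM : ∀ x ≠ 0, 0 < x ⬝ᵥ M *ᵥ x) :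
    ∃ c : ℝ, 0 < c ∧ ∀ x ≠ 0, 0 < x ⬝ᵥ (M - c • (1 : Matrix n n ℝ)) *ᵥ x := by
  have hcont : Filter.Tendsto (fun c : ℝ => M - c • (1 : Matrix n n ℝ)) (𝓝 0) (𝓝 M) := by
    have : Continuous fun c : ℝ => M - c • (1 : Matrix n n ℝ) := by fun_prop
    simpa using this.tendsto 0
  have h := (hcont.eventually (Matrix.eventually_dotProduct_mulVec_pos hM)).filter_mono
    (nhdsWithin_le_nhds (s := Set.Ioi 0))
  obtain ⟨c, hc, hc0⟩ := (h.and self_mem_nhdsWithin).exists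
  exact ⟨c, hc0, hc⟩

lemma Matrix.PosSemidef.dotProduct_add_mul_transpose_mulVec_pos {n k : Type*} [Fintype n]
    [Fintype k] {A : Matrix n n ℝ} {E : Matrix n k ℝ} [DecidableEq k]
    (hA : A.PosSemidef) (horth : Eᵀ * E = 1)
    (hker : ∀ x, A *ᵥ x = 0 → ∃ c, E *ᵥ c = x) {x : n → ℝ} (hx : x ≠ 0) :
    0 < x ⬝ᵥ (A + E * Eᵀ) *ᵥ x := by
  have hsq : x ⬝ᵥ (E * Eᵀ) *ᵥ x = (Eᵀ *ᵥ x) ⬝ᵥ (Eᵀ *ᵥ x) := by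
    rw [← Matrix.mulVec_mulVec, Matrix.dotProduct_mulVec, ← Matrix.mulVec_transpose]
  have h1 : 0 ≤ x ⬝ᵥ A *ᵥ x := by simpa using hA.dotProduct_mulVec_nonneg x
  have h2 : 0 ≤ (Eᵀ *ᵥ x) ⬝ᵥ (Eᵀ *ᵥ x) := Finset.sum_nonneg fun i _ => mul_self_nonneg _
  rw [Matrix.add_mulVec, dotProduct_add, hsq]
  refine (add_nonneg h1 h2).lt_of_ne' fun h0 => hx ?_
  have hAx : A *ᵥ x = 0 := (hA.dotProduct_mulVec_zero_iff x).mp (by simp; linarith)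
  have hEx : Eᵀ *ᵥ x = 0 := dotProduct_self_eq_zero.mp (by linarith)
  obtain ⟨c, rfl⟩ := hker x hAx
  rw [Matrix.mulVec_mulVec, horth, Matrix.one_mulVec] at hEx
  rw [hEx, Matrix.mulVec_zero]

section Spectral

variable {n k : Type*} [Fintype n] [Fintype k]
  {A : Matrix n n ℝ} {E : Matrix n k ℝ} {c : ℝ}

lemma transpose_mul_eq_of_invariant (hsymm : A.IsSymm) (hAE : A * E = E * (Eᵀ * (A * E))) :
    Eᵀ * A = Eᵀ * (A * E) * Eᵀ := by
  have := congrArg Matrix.transpose hAE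
  simpa only [Matrix.transpose_mul, Matrix.transpose_transpose, hsymm.eq, Matrix.mul_assoc]
    using this

variable [DecidableEq k]

lemma transpose_mulVec_eq_zero_of_lt (hsymm : A.IsSymm)
    (hAE : A * E = E * (Eᵀ * (A * E)))
    (hpos : ∀ x ≠ 0, 0 < x ⬝ᵥ (c • (1 : Matrix k k ℝ) - Eᵀ * (A * E)) *ᵥ x)
    {μ : ℝ} {v : n → ℝ} (hv : A *ᵥ v = μ • v) (hμ : c < μ) : Eᵀ *ᵥ v = 0 := by
  by_contra hne
  have hlt := hpos _ hne
  rw [Matrix.sub_mulVec, Matrix.mulVec_mulVec _ (Eᵀ * (A * E)),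
    ← transpose_mul_eq_of_invariant hsymm hAE, ← Matrix.mulVec_mulVec, hv, Matrix.mulVec_smul,
    Matrix.smul_mulVec, Matrix.one_mulVec, ← sub_smul, dotProduct_smul, smul_eq_mul] at hlt
  have hww : 0 ≤ (Eᵀ *ᵥ v) ⬝ᵥ (Eᵀ *ᵥ v) := Finset.sum_nonneg fun i _ => mul_self_nonneg _
  exact absurd hlt (mul_nonpos_of_nonpos_of_nonneg (sub_nonpos.mpr hμ.le) hww).not_gt

variable [DecidableEq n]

lemma mulVec_transpose_mulVec_eq_self_of_le (hsymm : A.IsSymm) (horth : Eᵀ * E = 1)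
    (hAE : A * E = E * (Eᵀ * (A * E)))
    (hpos : ∀ x ≠ 0, 0 < x ⬝ᵥ (A + E * Eᵀ - c • (1 : Matrix n n ℝ)) *ᵥ x)
    {μ : ℝ} {v : n → ℝ} (hv : A *ᵥ v = μ • v) (hμ : μ ≤ c) : E *ᵥ (Eᵀ *ᵥ v) = v := by
  have hEw : Eᵀ *ᵥ (v - E *ᵥ (Eᵀ *ᵥ v)) = 0 := by
    rw [Matrix.mulVec_sub, Matrix.mulVec_mulVec, horth, Matrix.one_mulVec, sub_self]
  have hAw : A *ᵥ (v - E *ᵥ (Eᵀ *ᵥ v)) = μ • (v - E *ᵥ (Eᵀ *ᵥ v)) := by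
    rw [Matrix.mulVec_sub, smul_sub, hv, Matrix.mulVec_mulVec, hAE, Matrix.mulVec_mulVec,
      Matrix.mul_assoc, ← transpose_mul_eq_of_invariant hsymm hAE, ← Matrix.mulVec_mulVec,
      ← Matrix.mulVec_mulVec, hv, Matrix.mulVec_smul, Matrix.mulVec_smul]
  by_contra hne
  have hw : v - E *ᵥ (Eᵀ *ᵥ v) ≠ 0 := fun h => hne (sub_eq_zero.mp h).symm
  have hlt := hpos _ hw
  generalize v - E *ᵥ (Eᵀ *ᵥ v) = w at *
  rw [Matrix.sub_mulVec, Matrix.add_mulVec, hAw, ← Matrix.mulVec_mulVec, hEw, Matrix.mulVec_zero,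
    Matrix.smul_mulVec, Matrix.one_mulVec, add_zero, ← sub_smul, dotProduct_smul,
    smul_eq_mul] at hlt
  have hww : 0 ≤ w ⬝ᵥ w := Finset.sum_nonneg fun i _ => mul_self_nonneg _
  exact absurd hlt (mul_nonpos_of_nonpos_of_nonneg (sub_nonpos.mpr hμ) hww).not_gt

lemma sum_dotProduct_smul_eq_self {v : n → n → ℝ}
    (hv : ∀ i j, v i ⬝ᵥ v j = if i = j then (1 : ℝ) else 0) (x : n → ℝ) :
    ∑ i, (v i ⬝ᵥ x) • v i = x := by
  have h1 : Matrix.of v * (Matrix.of v)ᵀ = 1 := by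
    ext i j
    simpa [Matrix.mul_apply, Matrix.one_apply, dotProduct] using hv i j
  have h2 : (Matrix.of v)ᵀ *ᵥ (Matrix.of v *ᵥ x) = x := by
    rw [Matrix.mulVec_mulVec, mul_eq_one_comm.mp h1, Matrix.one_mulVec]
  rw [Matrix.mulVec_eq_sum] at h2
  simpa [Matrix.mulVec] using! h2

lemma card_eq_of_orthonormal_projection {v : n → n → ℝ} (horth : Eᵀ * E = 1)
    (hv : ∀ i j, v i ⬝ᵥ v j = if i = j then (1 : ℝ) else 0) (s : Finset n)
    (hmem : ∀ i ∈ s, E *ᵥ (Eᵀ *ᵥ v i) = v i) (hnmem : ∀ i ∉ s, Eᵀ *ᵥ v i = 0) :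
    s.card = Fintype.card k := by
  have h1 : (Matrix.of v)ᵀ * Matrix.of v = 1 := by
    rw [mul_eq_one_comm]
    ext i j
    simpa [Matrix.mul_apply, Matrix.one_apply, dotProduct] using hv i j
  have h2 : (Matrix.of v * (E * Eᵀ) * (Matrix.of v)ᵀ).trace = Fintype.card k := by
    rw [Matrix.trace_mul_comm, ← Matrix.mul_assoc, h1, Matrix.one_mul, Matrix.trace_mul_comm,
      horth, Matrix.trace_one]
  have h3 : (Matrix.of v * (E * Eᵀ) * (Matrix.of v)ᵀ).trace = ∑ i, if i ∈ s then (1 : ℝ) else 0 := by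
    refine Finset.sum_congr rfl fun i _ => ?_
    have h4 : (Matrix.of v * (E * Eᵀ) * (Matrix.of v)ᵀ).diag i =
        v i ⬝ᵥ E *ᵥ (Eᵀ *ᵥ v i) := by
      rw [Matrix.mulVec_mulVec, Matrix.mul_assoc]
      rfl
    rw [h4]
    split_ifs with hi
    · rw [hmem i hi, hv, if_pos rfl]
    · rw [hnmem i hi, Matrix.mulVec_zero, dotProduct_zero]
  rw [h2] at h3
  simpa using h3.symm

end Spectral

lemma Fin.eq_filter_le_of_isUpperSet {m r : ℕ} {s : Finset (Fin m)}
    (hs : IsUpperSet (s : Set (Fin m))) (hcard : s.card = m - r) :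
    s = Finset.univ.filter fun i : Fin m => r ≤ (i : ℕ) := by
  have hcard' : (Finset.univ.filter fun i : Fin m => r ≤ (i : ℕ)).card = m - r := by
    have h1 := Finset.card_filter_add_card_filter_not (s := (Finset.univ : Finset (Fin m)))
      (fun i : Fin m => (i : ℕ) < r)
    simp only [not_lt, Fin.card_filter_val_lt, Finset.card_univ, Fintype.card_fin] at h1
    omega
  have ht : IsUpperSet ((Finset.univ.filter fun i : Fin m => r ≤ (i : ℕ) : Finset (Fin m)) :
      Set (Fin m)) := by
    intro a b hab ha
    simp only [Finset.coe_filter, Finset.mem_univ, true_and, Set.mem_ofPred_eq] at ha ⊢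
    exact ha.trans hab
  rcases hs.total ht with h | h
  · exact Finset.eq_of_subset_of_card_le (Finset.coe_subset.mp h) (by omega)
  · exact (Finset.eq_of_subset_of_card_le (Finset.coe_subset.mp h) (by omega)).symm

lemma Matrix.setOf_exists_eq_column {n k : Type*} (E : Matrix n k ℝ) :
    {x : n → ℝ | ∃ j, x = fun i => E i j} = Set.range E.col :=
  Set.ext fun _ => exists_congr fun _ => eq_comm

theorem span_columns_eq_span_eigenvectors {m r : ℕ} {A : Matrix (Fin m) (Fin m) ℝ}
    {E : Matrix (Fin m) (Fin (m - r)) ℝ} {c : ℝ} (hsymm : A.IsSymm) (horth : Eᵀ * E = 1)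
    (hAE : A * E = E * (Eᵀ * (A * E)))
    (hpos : ∀ x ≠ 0, 0 < x ⬝ᵥ (A + E * Eᵀ - c • (1 : Matrix (Fin m) (Fin m) ℝ)) *ᵥ x)
    (hpos' : ∀ x ≠ 0,
      0 < x ⬝ᵥ (c • (1 : Matrix (Fin (m - r)) (Fin (m - r)) ℝ) - Eᵀ * (A * E)) *ᵥ x)
    {μ : Fin m → ℝ} {v : Fin m → Fin m → ℝ} (hAv : ∀ i, A *ᵥ v i = μ i • v i)
    (hv : ∀ i j, v i ⬝ᵥ v j = if i = j then (1 : ℝ) else 0) (hμ : Antitone μ) :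
    Submodule.span ℝ {x : Fin m → ℝ | ∃ j, x = fun i => E i j} =
      Submodule.span ℝ {x : Fin m → ℝ | ∃ i : Fin m, r ≤ (i : ℕ) ∧ x = v i} := by
  have hlow (i) (hi : μ i ≤ c) : E *ᵥ (Eᵀ *ᵥ v i) = v i :=
    mulVec_transpose_mulVec_eq_self_of_le hsymm horth hAE hpos (hAv i) hi
  have hhigh (i) (hi : c < μ i) : Eᵀ *ᵥ v i = 0 :=
    transpose_mulVec_eq_zero_of_lt hsymm hAE hpos' (hAv i) hi
  have hcard : (Finset.univ.filter fun i => μ i ≤ c).card = m - r := by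
    simpa using card_eq_of_orthonormal_projection horth hv (Finset.univ.filter fun i => μ i ≤ c)
      (fun i hi => hlow i (by simpa using hi)) (fun i hi => hhigh i (by simpa using hi))
  have hset := Fin.eq_filter_le_of_isUpperSet (r := r) (fun a b hab ha => by
    simp only [Finset.coe_filter, Finset.mem_univ, true_and, Set.mem_ofPred_eq] at ha ⊢
    exact (hμ hab).trans ha) hcard
  have hiff (i : Fin m) : μ i ≤ c ↔ r ≤ (i : ℕ) := by
    simpa using Finset.ext_iff.mp hset i
  refine le_antisymm (Submodule.span_le.mpr ?_) (Submodule.span_le.mpr ?_)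
  · rintro _ ⟨j, rfl⟩
    rw [SetLike.mem_coe, ← sum_dotProduct_smul_eq_self hv fun i => E i j]
    refine Submodule.sum_mem _ fun i _ => ?_
    rcases le_or_gt (μ i) c with hi | hi
    · exact Submodule.smul_mem _ _ (Submodule.subset_span ⟨i, (hiff i).mp hi, rfl⟩)
    · have h0 : (v i ⬝ᵥ fun a => E a j) = 0 := by
        rw [dotProduct_comm]
        exact congrFun (hhigh i hi) j
      rw [h0, zero_smul]
      exact Submodule.zero_mem _
  · rintro _ ⟨i, hi, rfl⟩
    rw [SetLike.mem_coe, Matrix.setOf_exists_eq_column, ← Matrix.range_mulVecLin]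
    exact ⟨_, hlow i ((hiff i).mpr hi)⟩

end Eigenvectors

/-- Reduction lemma for the semidefinite cone: given `Ā ⪰ 0` of rank `r` and `Ē` with
orthonormal columns spanning `Ker(Ā)`, there is a neighborhood of `Ā` and an analytic map
`E` on it with `E(Ā) = Ē` whose columns form, for every symmetric `A` near `Ā`, an
orthonormal basis of the span of the eigenvectors associated with the `m - r` smallest
eigenvalues of `A`. -/
theorem stmt15 (m r : ℕ) (Abar : Matrix (Fin m) (Fin m) ℝ)
    (hpsd : Abar.PosSemidef) (hrank : Abar.rank = r)
    (Ebar : Matrix (Fin m) (Fin (m - r)) ℝ)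
    (horth : Ebarᵀ * Ebar = 1)
    (hspan : Submodule.span ℝ {x : Fin m → ℝ | ∃ j, x = fun i => Ebar i j} =
      LinearMap.ker Abar.mulVecLin) :
    ∃ (U : Set (Matrix (Fin m) (Fin m) ℝ))
      (E : Matrix (Fin m) (Fin m) ℝ → Matrix (Fin m) (Fin (m - r)) ℝ),
      U ∈ nhds Abar ∧ (∀ A ∈ U, AnalyticAt ℝ E A) ∧ E Abar = Ebar ∧
      ∀ A ∈ U, A.IsSymm →
        ((E A)ᵀ * E A = 1) ∧
        ∀ (μ : Fin m → ℝ) (v : Fin m → (Fin m → ℝ)),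
          (∀ i, A.mulVec (v i) = μ i • v i) →
          (∀ i j, v i ⬝ᵥ v j = if i = j then (1 : ℝ) else 0) →
          Antitone μ →
          Submodule.span ℝ {x : Fin m → ℝ | ∃ j, x = fun i => E A i j} =
            Submodule.span ℝ {x : Fin m → ℝ | ∃ i : Fin m, r ≤ (i : ℕ) ∧ x = v i} := by
  rw [Matrix.setOf_exists_eq_column, ← Matrix.range_mulVecLin] at hspan
  have hAE : Abar * Ebar = 0 := by
    refine Matrix.ext_of_mulVec_single fun j => ?_
    have : Ebar *ᵥ Pi.single j 1 ∈ LinearMap.ker Abar.mulVecLin := hspan ▸ ⟨_, rfl⟩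
    rw [← Matrix.mulVec_mulVec, Matrix.zero_mulVec]
    exact this
  have hker (x : Fin m → ℝ) (hx : Abar *ᵥ x = 0) : ∃ c, Ebar *ᵥ c = x := by
    have : x ∈ LinearMap.range Ebar.mulVecLin := hspan ▸ hx
    exact this
  have hsymm : Abar.IsSymm := by simpa using! hpsd.isHermitian
  obtain ⟨E, hEan, hE0, hEinv⟩ := exists_analyticAt_invariant_frame hsymm horth hAE hker
  obtain ⟨c, hc, hcpos⟩ := exists_pos_dotProduct_sub_smul_one_mulVec_pos fun x hx =>
    hpsd.dotProduct_add_mul_transpose_mulVec_pos horth hker hx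
  have hcont := hEan.continuousAt
  have hpos : ∀ᶠ A in 𝓝 Abar, ∀ x ≠ 0,
      0 < x ⬝ᵥ (A + E A * (E A)ᵀ - c • (1 : Matrix (Fin m) (Fin m) ℝ)) *ᵥ x := by
    have h : ContinuousAt
        (fun A => A + E A * (E A)ᵀ - c • (1 : Matrix (Fin m) (Fin m) ℝ)) Abar := by
      have h' : Continuous fun p : Matrix (Fin m) (Fin m) ℝ × Matrix (Fin m) (Fin (m - r)) ℝ =>
        p.1 + p.2 * p.2ᵀ - c • (1 : Matrix (Fin m) (Fin m) ℝ) := by fun_prop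
      exact h'.continuousAt.comp (f := fun A => (A, E A)) (continuousAt_id.prodMk hcont)
    exact h.eventually (Matrix.eventually_dotProduct_mulVec_pos (by simpa only [hE0] using hcpos))
  have hpos' : ∀ᶠ A in 𝓝 Abar, ∀ x ≠ 0,
      0 < x ⬝ᵥ (c • (1 : Matrix (Fin (m - r)) (Fin (m - r)) ℝ) - (E A)ᵀ * (A * E A)) *ᵥ x := by
    have h : ContinuousAt (fun A =>
        c • (1 : Matrix (Fin (m - r)) (Fin (m - r)) ℝ) - (E A)ᵀ * (A * E A)) Abar := by
      have h' : Continuous fun p : Matrix (Fin m) (Fin m) ℝ × Matrix (Fin m) (Fin (m - r)) ℝ =>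
        c • (1 : Matrix (Fin (m - r)) (Fin (m - r)) ℝ) - p.2ᵀ * (p.1 * p.2) := by fun_prop
      exact h'.continuousAt.comp (f := fun A => (A, E A)) (continuousAt_id.prodMk hcont)
    refine h.eventually (Matrix.eventually_dotProduct_mulVec_pos fun x hx => ?_)
    beta_reduce
    rw [hE0, hAE, Matrix.mul_zero, sub_zero, Matrix.smul_mulVec, Matrix.one_mulVec,
      dotProduct_smul, smul_eq_mul]
    refine mul_pos hc ((Finset.sum_nonneg fun i _ => mul_self_nonneg (x i)).lt_of_ne' ?_)
    exact fun h0 => hx (dotProduct_self_eq_zero.mp h0)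
  refine ⟨{A | AnalyticAt ℝ E A ∧ ((E A)ᵀ * E A = 1 ∧ A * E A = E A * ((E A)ᵀ * (A * E A))) ∧
      (∀ x ≠ 0, 0 < x ⬝ᵥ (A + E A * (E A)ᵀ - c • (1 : Matrix (Fin m) (Fin m) ℝ)) *ᵥ x) ∧
      ∀ x ≠ 0,
        0 < x ⬝ᵥ (c • (1 : Matrix (Fin (m - r)) (Fin (m - r)) ℝ) - (E A)ᵀ * (A * E A)) *ᵥ x},
    E, ?_, fun A hA => hA.1, hE0, ?_⟩
  · filter_upwards [hEan.eventually_analyticAt, hEinv, hpos, hpos'] with A h1 h2 h3 h4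
    exact ⟨h1, h2, h3, h4⟩
  · intro A hU hA
    exact ⟨hU.2.1.1, fun μ v hAv hv hμ =>
      span_columns_eq_span_eigenvectors hA hU.2.1.1 hU.2.1.2 hU.2.2.1 hU.2.2.2 hAv hv hμ⟩
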